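/- arXiv:2109.04679 — 4 statements merged into one kernel-verified Lean document; each statement's English description precedes it below -/
import Mathlib

section
/- (Theorem 3.3, sufficiency) Let n ≥ 1, let A_1, ..., A_n : I → ℂ and let A_0 : I → ℝ be real-valued, and let 𝓛 be the difference expression (𝓛y)(t) = Σ_{j=0}^{n} A_j(t+j) y(t+j) + Σ_{j=1}^{n} conj(A_j(t)) y(t−j) on l(I,n). Then 𝓛 is formally self-adjoint: there exists a map assigning to each x, y ∈ l(I,n) a sequence s[x,y] on I, linear in x and conjugate-linear in y for each t ∈ I, such that conj(y(t))·(𝓛x)(t) − conj((𝓛y)(t))·x(t) = (Δ s[x,y])(t) for all x, y ∈ l(I,n) and t ∈ I. -/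
open Finset ComplexConjugate

noncomputable section

/-- The canonical `2n`-th order difference expression
`(𝓛y)(t) = ∑_{j=0}^{n} A_j(t+j) y(t+j) + ∑_{j=1}^{n} conj(A_j(t)) y(t−j)`,
for sequences `y ∈ l(I,n)` (modeled as functions `ℤ → ℂ`). -/
def Lcal (A : ℕ → ℕ → ℂ) (n : ℕ) (y : ℤ → ℂ) (t : ℕ) : ℂ :=
  ∑ j ∈ Finset.range (n + 1), A j (t + j) * y ((t : ℤ) + j)
    + ∑ j ∈ Finset.Icc 1 n, conj (A j t) * y ((t : ℤ) - j)

/-- The contribution of the coefficient `a = A_j` to the boundary form at the point `t`. -/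
def boundaryTerm (a : ℕ → ℂ) (j : ℕ) (x y : ℤ → ℂ) (t : ℕ) : ℂ :=
  a t * x t * conj (y ((t : ℤ) - j)) - conj (a t * y t) * x ((t : ℤ) - j)

/-- The boundary form `s[x,y]` of the Lagrange identity for `𝓛`. It depends only on the values of
`x` and `y` at the points `t - n, …, t + n - 1`. -/
def boundaryForm (A : ℕ → ℕ → ℂ) (n : ℕ) (x y : ℤ → ℂ) (t : ℕ) : ℂ :=
  ∑ j ∈ Finset.Icc 1 n, ∑ k ∈ Finset.range j, boundaryTerm (A j) j x y (t + k)

theorem boundaryForm_linear_left (A : ℕ → ℕ → ℂ) (n : ℕ) (a b : ℂ) (x₁ x₂ y : ℤ → ℂ) (t : ℕ) :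
    boundaryForm A n (fun u => a * x₁ u + b * x₂ u) y t
      = a * boundaryForm A n x₁ y t + b * boundaryForm A n x₂ y t := by
  simp only [boundaryForm, Finset.mul_sum, ← Finset.sum_add_distrib]
  refine Finset.sum_congr rfl fun j _ => Finset.sum_congr rfl fun k _ => ?_
  simp only [boundaryTerm]
  ring

theorem boundaryForm_conjLinear_right (A : ℕ → ℕ → ℂ) (n : ℕ) (a b : ℂ) (x y₁ y₂ : ℤ → ℂ)
    (t : ℕ) :
    boundaryForm A n x (fun u => a * y₁ u + b * y₂ u) t
      = conj a * boundaryForm A n x y₁ t + conj b * boundaryForm A n x y₂ t := by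
  simp only [boundaryForm, Finset.mul_sum, ← Finset.sum_add_distrib]
  refine Finset.sum_congr rfl fun j _ => Finset.sum_congr rfl fun k _ => ?_
  simp only [boundaryTerm, map_add, map_mul]
  ring

theorem boundaryForm_succ_sub (A : ℕ → ℕ → ℂ) (n : ℕ) (x y : ℤ → ℂ) (t : ℕ) :
    boundaryForm A n x y (t + 1) - boundaryForm A n x y t
      = ∑ j ∈ Finset.Icc 1 n,
          (boundaryTerm (A j) j x y (t + j) - boundaryTerm (A j) j x y t) := by
  simp only [boundaryForm, ← Finset.sum_sub_distrib]
  refine Finset.sum_congr rfl fun j _ => ?_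
  simpa only [add_zero, add_assoc, add_comm 1]
    using Finset.sum_range_sub (fun k => boundaryTerm (A j) j x y (t + k)) j

theorem Lcal_eq (A : ℕ → ℕ → ℂ) (n : ℕ) (y : ℤ → ℂ) (t : ℕ) :
    Lcal A n y t = A 0 t * y t + ∑ j ∈ Finset.Icc 1 n,
      (A j (t + j) * y ((t : ℤ) + j) + conj (A j t) * y ((t : ℤ) - j)) := by
  have hIco : Finset.Ico 1 (n + 1) = Finset.Icc 1 n := by
    ext j
    simp only [Finset.mem_Ico, Finset.mem_Icc]
    omega
  rw [Lcal, Finset.range_eq_Ico, Finset.sum_eq_sum_Ico_succ_bot n.succ_pos, zero_add, hIco,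
    Finset.sum_add_distrib]
  simp only [add_zero, Nat.cast_zero, add_assoc]

/-- Theorem 3.3 (sufficiency): if `A_0` is real-valued, the canonical expression `𝓛`
is formally self-adjoint: there is a map assigning to each `x, y ∈ l(I,n)` a sequence
`s[x,y]` on `I`, linear in `x` and conjugate-linear in `y` at each `t`, with
`conj(y(t))·(𝓛x)(t) − conj((𝓛y)(t))·x(t) = (Δ s[x,y])(t)` for all `x, y, t`. -/
theorem canonical_formally_selfAdjoint (n : ℕ) (hn : 1 ≤ n)
    (A : ℕ → ℕ → ℂ) (hA0 : ∀ t : ℕ, (A 0 t).im = 0) :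
    ∃ s : (ℤ → ℂ) → (ℤ → ℂ) → ℕ → ℂ,
      (∀ a b : ℂ, ∀ x₁ x₂ y : ℤ → ℂ, ∀ t : ℕ,
          s (fun u => a * x₁ u + b * x₂ u) y t = a * s x₁ y t + b * s x₂ y t) ∧
      (∀ a b : ℂ, ∀ x y₁ y₂ : ℤ → ℂ, ∀ t : ℕ,
          s x (fun u => a * y₁ u + b * y₂ u) t
            = conj a * s x y₁ t + conj b * s x y₂ t) ∧
      (∀ x y : ℤ → ℂ, ∀ t : ℕ,
          conj (y (t : ℤ)) * Lcal A n x t - conj (Lcal A n y t) * x (t : ℤ)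
            = s x y (t + 1) - s x y t) := by
  refine ⟨boundaryForm A n, boundaryForm_linear_left A n, boundaryForm_conjLinear_right A n,
    fun x y t => ?_⟩
  have hreal : conj (A 0 t) = A 0 t := Complex.conj_eq_iff_im.mpr (hA0 t)
  rw [boundaryForm_succ_sub, Lcal_eq, Lcal_eq, map_add, map_mul, map_sum, hreal, mul_add, add_mul,
    Finset.mul_sum, Finset.sum_mul, mul_left_comm, ← mul_assoc, add_sub_add_left_eq_sub,
    ← Finset.sum_sub_distrib]
  refine Finset.sum_congr rfl fun j _ => ?_
  simp only [boundaryTerm, map_add, map_mul, Complex.conj_conj, Nat.cast_add, add_sub_cancel_right]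
  ring
end
end

section
/- (Theorem 3.3, necessity) Let k, s ≥ 1, m = k + s, and let A_j : I → ℂ for −s ≤ j ≤ k be coefficient functions with A_k(t+k) ≠ 0 and A_{−s}(t) ≠ 0 for all t ∈ I. Define the m-th order difference expression (Ly)(t) = Σ_{j=0}^{k} A_j(t+j) y(t+j) + Σ_{j=1}^{s} A_{−j}(t) y(t−j) and its formal adjoint (L^+ y)(t) = Σ_{j=1}^{s} conj(A_{−j}(t+j)) y(t+j) + Σ_{j=0}^{k} conj(A_j(t)) y(t−j), for y ∈ l(I,m) and t ∈ I. If (Ly)(t) = (L^+ y)(t) for all y ∈ l(I,m) and all t ∈ I, then k = s (so the order m = 2k is even), A_{−j}(t) = conj(A_j(t)) for all 1 ≤ j ≤ k and t ∈ I, and A_0(t) is real for all t ∈ I. -/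
open Finset ComplexConjugate

noncomputable section

/-- A general `m`-th order difference expression (`m = k + s`):
`(Ly)(t) = ∑_{j=0}^{k} A_j(t+j) y(t+j) + ∑_{j=1}^{s} A_{−j}(t) y(t−j)`,
for sequences `y ∈ l(I,m)` (modeled as functions `ℤ → ℂ`). -/
def Lgen (A : ℤ → ℕ → ℂ) (k s : ℕ) (y : ℤ → ℂ) (t : ℕ) : ℂ :=
  ∑ j ∈ Finset.range (k + 1), A j (t + j) * y ((t : ℤ) + j)
    + ∑ j ∈ Finset.Icc 1 s, A (-(j : ℤ)) t * y ((t : ℤ) - j)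

/-- Its formal adjoint:
`(L⁺y)(t) = ∑_{j=1}^{s} conj(A_{−j}(t+j)) y(t+j) + ∑_{j=0}^{k} conj(A_j(t)) y(t−j)`. -/
def LgenAdj (A : ℤ → ℕ → ℂ) (k s : ℕ) (y : ℤ → ℂ) (t : ℕ) : ℂ :=
  ∑ j ∈ Finset.Icc 1 s, conj (A (-(j : ℤ)) (t + j)) * y ((t : ℤ) + j)
    + ∑ j ∈ Finset.range (k + 1), conj (A j t) * y ((t : ℤ) - j)

/-- The coefficients of `y (t - j)`, `j ≥ 1`, in `Ly = L⁺y` agree. -/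
theorem backward_coeff_eq {k s : ℕ} {A : ℤ → ℕ → ℂ}
    (h : ∀ y : ℤ → ℂ, ∀ t : ℕ, Lgen A k s y t = LgenAdj A k s y t)
    {j : ℕ} (hj : 1 ≤ j) (t : ℕ) :
    (if j ≤ s then A (-(j : ℤ)) t else 0) = if j ≤ k then conj (A j t) else 0 := by
  have hy := h (Pi.single ((t : ℤ) - j) 1) t
  have forward (i : ℕ) : (t : ℤ) + i ≠ t - j := by omega
  have backward (i : ℕ) : (t : ℤ) - i = t - j ↔ j = i := by omega
  simpa [Lgen, LgenAdj, Pi.single_apply, forward, backward, hj, Nat.lt_succ_iff] using hy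

/-- The coefficients of `y t` in `Ly = L⁺y` agree. -/
theorem central_coeff_eq {k s : ℕ} {A : ℤ → ℕ → ℂ}
    (h : ∀ y : ℤ → ℂ, ∀ t : ℕ, Lgen A k s y t = LgenAdj A k s y t) (t : ℕ) :
    A 0 t = conj (A 0 t) := by
  have hy := h (Pi.single (t : ℤ) 1) t
  simpa [Lgen, LgenAdj, Pi.single_apply] using hy

/-- Theorem 3.3 (necessity): if `L = L⁺` (pointwise, on all of `l(I,m)`), where the leading
coefficients never vanish, then `k = s` (so the order `m = 2k` is even),
`A_{−j}(t) = conj(A_j(t))` for `1 ≤ j ≤ k`, and `A_0` is real-valued. -/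
theorem formally_selfAdjoint_necessity (k s : ℕ) (hk : 1 ≤ k) (hs : 1 ≤ s)
    (A : ℤ → ℕ → ℂ)
    (hAk : ∀ t : ℕ, A (k : ℤ) (t + k) ≠ 0)
    (hAs : ∀ t : ℕ, A (-(s : ℤ)) t ≠ 0)
    (h : ∀ y : ℤ → ℂ, ∀ t : ℕ, Lgen A k s y t = LgenAdj A k s y t) :
    k = s ∧
    (∀ j ∈ Finset.Icc 1 k, ∀ t : ℕ, A (-(j : ℤ)) t = conj (A (j : ℤ) t)) ∧
    (∀ t : ℕ, (A 0 t).im = 0) := by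
  have hks : k = s := by
    rcases lt_trichotomy k s with hlt | heq | hgt
    · have := backward_coeff_eq h hs 0
      simp [hlt.not_ge, hAs] at this
    · exact heq
    · have := backward_coeff_eq h hk k
      rw [if_neg hgt.not_ge, if_pos le_rfl, eq_comm, map_eq_zero] at this
      exact absurd this (by simpa using hAk 0)
  subst hks
  refine ⟨rfl, fun j hj t => ?_, fun t => ?_⟩
  · obtain ⟨hj, hjk⟩ := Finset.mem_Icc.mp hj
    simpa [hjk] using backward_coeff_eq h hj t
  · exact Complex.conj_eq_iff_im.mp (central_coeff_eq h t).symm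
end
end

section
/- (Theorem 3.4) Let L_n be an n-th order forward difference expression with coefficients B_0, ..., B_n : I → ℂ, and define D_j(t) = Σ_{k=j}^{n} B_k(t+k−j)·conj(B_{k−j}(t+k−j)) for 0 ≤ j ≤ n and t ∈ I. Then for every y ∈ l(I,n) and every t ∈ I, (L_n(L_n^+ y))(t) = Σ_{j=0}^{n} D_j(t+j) y(t+j) + Σ_{j=1}^{n} conj(D_j(t)) y(t−j), and D_0(t) = Σ_{k=0}^{n} |B_k(t+k)|² is real-valued on I. Consequently, L_n L_n^+ is a formally self-adjoint difference expression of order 2n. -/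
open Finset ComplexConjugate

noncomputable section

/-- The formal adjoint `(Lₙ⁺ y)(t) = ∑_{j=0}^{n} conj(B_j(t)) y(t-j)` of the `n`-th order
forward difference expression `(Lₙ y)(t) = ∑_{j=0}^{n} B_j(t+j) y(t+j)`. -/
def LnAdj (B : ℕ → ℕ → ℂ) (n : ℕ) (y : ℤ → ℂ) (t : ℕ) : ℂ :=
  ∑ j ∈ Finset.range (n + 1), conj (B j t) * y ((t : ℤ) - j)

/-- The composition `(Lₙ(Lₙ⁺y))(t) = ∑_{j=0}^{n} B_j(t+j)·(Lₙ⁺y)(t+j)`. -/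
def LnLnAdj (B : ℕ → ℕ → ℂ) (n : ℕ) (y : ℤ → ℂ) (t : ℕ) : ℂ :=
  ∑ j ∈ Finset.range (n + 1), B j (t + j) * LnAdj B n y (t + j)

/-- `D_j(t) = ∑_{k=j}^{n} B_k(t+k−j)·conj(B_{k−j}(t+k−j))`. -/
def Dcoef (B : ℕ → ℕ → ℂ) (n j t : ℕ) : ℂ :=
  ∑ k ∈ Finset.Icc j n, B k (t + k - j) * conj (B (k - j) (t + k - j))

/-- A sum over a square, regrouped along the diagonals on and below, and strictly above, the
main one. -/
theorem sum_range_square_eq_sum_diagonals {M : Type*} [AddCommMonoid M] (n : ℕ)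
    (f : ℕ → ℕ → M) :
    ∑ j ∈ Finset.range (n + 1), ∑ i ∈ Finset.range (n + 1), f j i
      = ∑ m ∈ Finset.range (n + 1), ∑ k ∈ Finset.Icc m n, f k (k - m)
        + ∑ m ∈ Finset.Icc 1 n, ∑ k ∈ Finset.Icc m n, f (k - m) k := by
  rw [← Finset.sum_product', Finset.sum_sigma', Finset.sum_sigma',
    ← Finset.sum_filter_add_sum_filter_not _ (fun p : ℕ × ℕ => p.2 ≤ p.1)]
  congr 1
  · refine Finset.sum_bij' (fun p _ => ⟨p.1 - p.2, p.1⟩) (fun q _ => (q.2, q.2 - q.1))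
      ?_ ?_ ?_ ?_ ?_
    · rintro ⟨a, b⟩ h
      simp at h ⊢
      omega
    · rintro ⟨a, b⟩ h
      simp at h ⊢
      omega
    · rintro ⟨a, b⟩ h
      simp at h ⊢
      omega
    · rintro ⟨a, b⟩ h
      simp at h ⊢
      omega
    · rintro ⟨a, b⟩ h
      simp only [Finset.mem_filter] at h
      simp only [Nat.sub_sub_self h.2]
  · refine Finset.sum_bij' (fun p _ => ⟨p.2 - p.1, p.2⟩) (fun q _ => (q.2 - q.1, q.2))
      ?_ ?_ ?_ ?_ ?_
    · rintro ⟨a, b⟩ h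
      simp at h ⊢
      omega
    · rintro ⟨a, b⟩ h
      simp at h ⊢
      omega
    · rintro ⟨a, b⟩ h
      simp at h ⊢
      omega
    · rintro ⟨a, b⟩ h
      simp at h ⊢
      omega
    · rintro ⟨a, b⟩ h
      simp only [Finset.mem_filter, not_le] at h
      simp only [Nat.sub_sub_self h.2.le]

/-- Theorem 3.4: `LₙLₙ⁺` is a formally self-adjoint difference expression of order `2n`:
it has the canonical form with coefficients `D_j`, and
`D_0(t) = ∑_{k=0}^{n} |B_k(t+k)|²` is real-valued on `I`. -/
theorem LnLnAdj_formally_selfAdjoint (n : ℕ) (hn : 1 ≤ n) (B : ℕ → ℕ → ℂ) :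
    (∀ y : ℤ → ℂ, ∀ t : ℕ,
        LnLnAdj B n y t
          = ∑ j ∈ Finset.range (n + 1), Dcoef B n j (t + j) * y ((t : ℤ) + j)
            + ∑ j ∈ Finset.Icc 1 n, conj (Dcoef B n j t) * y ((t : ℤ) - j)) ∧
    (∀ t : ℕ,
        Dcoef B n 0 t
          = ((∑ k ∈ Finset.range (n + 1), Complex.normSq (B k (t + k)) : ℝ) : ℂ)) := by
  refine ⟨fun y t => ?_, fun t => ?_⟩
  · simp only [LnLnAdj, LnAdj, Dcoef, Finset.mul_sum, Finset.sum_mul, map_sum]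
    rw [sum_range_square_eq_sum_diagonals]
    congr 1
    · refine Finset.sum_congr rfl fun m _ => Finset.sum_congr rfl fun k hk => ?_
      obtain ⟨i, rfl⟩ := Nat.exists_eq_add_of_le (Finset.mem_Icc.mp hk).1
      have ht : t + m + (m + i) - m = t + (m + i) := by omega
      have hy : ((t + (m + i) : ℕ) : ℤ) - (i : ℕ) = t + m := by push_cast; ring
      rw [ht, Nat.add_sub_cancel_left, hy, mul_assoc]
    · refine Finset.sum_congr rfl fun m _ => Finset.sum_congr rfl fun k hk => ?_
      obtain ⟨i, rfl⟩ := Nat.exists_eq_add_of_le (Finset.mem_Icc.mp hk).1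
      have ht : t + (m + i) - m = t + i := by omega
      have hy : ((t + i : ℕ) : ℤ) - (m + i : ℕ) = t - m := by push_cast; ring
      rw [ht, Nat.add_sub_cancel_left, hy, map_mul, Complex.conj_conj]
      ring
  · rw [Dcoef, Complex.ofReal_sum, Nat.range_succ_eq_Icc_zero]
    refine Finset.sum_congr rfl fun k _ => ?_
    rw [Nat.sub_zero, Nat.sub_zero, Complex.mul_conj]
end
end

section
/- (Nonnegativity of the relation generated by L_n L_n^+) Let L_n be an n-th order forward difference expression with coefficients B_0, ..., B_n : I → ℂ. If x ∈ l(I,n) satisfies x(t) = 0 for −n ≤ t ≤ n−1 and there exists k ∈ I such that x(t) = 0 for all t ≥ k, then Σ_{t∈I} conj(x(t))·(L_n(L_n^+ x))(t) = Σ_{t∈I} |(L_n^+ x)(t)|², both sums having only finitely many nonzero terms; in particular this quantity is real and nonnegative. Hence the pre-minimal relation generated by L_n L_n^+ in any weighted ℓ²-space is bounded from below with lower bound 0. -/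
open Finset ComplexConjugate

noncomputable section

section

variable {B : ℕ → ℕ → ℂ} {n k : ℕ} {x : ℤ → ℂ}

theorem LnAdj_eq_zero_of_le (hk : ∀ t : ℤ, (k : ℤ) ≤ t → x t = 0) {t : ℕ} (ht : k + n ≤ t) :
    LnAdj B n x t = 0 := by
  refine Finset.sum_eq_zero fun j hj => ?_
  have hj := Finset.mem_range.1 hj
  rw [hk _ (by omega), mul_zero]

theorem sum_range_shift {M : Type*} [AddCommMonoid M] {F : ℕ → M} {j : ℕ} (hj : j ≤ n)
    (h₀ : ∀ s < j, F s = 0) (h₁ : ∀ s, k + j ≤ s → F s = 0) :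
    ∑ t ∈ Finset.range k, F (t + j) = ∑ s ∈ Finset.range (k + n), F s := by
  obtain ⟨m, rfl⟩ := Nat.exists_eq_add_of_le hj
  rw [show k + (j + m) = j + (k + m) by ring, Finset.sum_range_add,
    Finset.sum_eq_zero fun s hs => h₀ s (Finset.mem_range.1 hs), zero_add,
    Finset.sum_range_add, Finset.sum_eq_zero (s := Finset.range m) fun s _ => h₁ _ (by omega),
    add_zero]
  exact Finset.sum_congr rfl fun t _ => by rw [add_comm]

theorem sum_conj_mul_LnLnAdj (hx0 : ∀ t : ℤ, -(n : ℤ) ≤ t → t < 0 → x t = 0)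
    (hk : ∀ t : ℤ, (k : ℤ) ≤ t → x t = 0) :
    ∑ t ∈ Finset.range k, conj (x (t : ℤ)) * LnLnAdj B n x t
      = ∑ t ∈ Finset.range (k + n), (Complex.normSq (LnAdj B n x t) : ℂ) := by
  have hsq (s : ℕ) : (Complex.normSq (LnAdj B n x s) : ℂ)
      = ∑ j ∈ Finset.range (n + 1), conj (x ((s : ℤ) - j)) * (B j s * LnAdj B n x s) := by
    rw [Complex.normSq_eq_conj_mul_self]
    nth_rewrite 1 [LnAdj]
    rw [map_sum, Finset.sum_mul]
    refine Finset.sum_congr rfl fun j _ => ?_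
    rw [map_mul, Complex.conj_conj]
    ring
  simp_rw [hsq, LnLnAdj, Finset.mul_sum]
  rw [Finset.sum_comm, Finset.sum_comm (s := Finset.range (k + n))]
  refine Finset.sum_congr rfl fun j hj => ?_
  have hj := Finset.mem_range.1 hj
  rw [← sum_range_shift (j := j) (by omega)]
  · refine Finset.sum_congr rfl fun t _ => ?_
    rw [Nat.cast_add, add_sub_cancel_right]
  · intro s hs
    rw [hx0 _ (by omega) (by omega), map_zero, zero_mul]
  · intro s hs
    rw [hk _ (by omega), map_zero, zero_mul]

end

/-- Nonnegativity of the relation generated by `LₙLₙ⁺`: if `x ∈ l(I,n)` vanishes for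
`−n ≤ t ≤ n−1` and for all large `t`, then
`∑_{t∈I} conj(x(t))·(Lₙ(Lₙ⁺x))(t) = ∑_{t∈I} |(Lₙ⁺x)(t)|²` (both sums having finitely
many nonzero terms); in particular this quantity is real and nonnegative.  Hence the
pre-minimal relation generated by `LₙLₙ⁺` in any weighted `ℓ²` space is bounded from
below with lower bound `0`: `⟨x,f⟩_w ≥ 0` whenever `Lₙ(Lₙ⁺x) = wf` on `I`. -/
theorem LnLnAdj_nonneg (n : ℕ) (hn : 1 ≤ n) (B : ℕ → ℕ → ℂ)
    (x : ℤ → ℂ)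
    (hx0 : ∀ t : ℤ, -(n : ℤ) ≤ t → t ≤ (n : ℤ) - 1 → x t = 0)
    (hxfin : ∃ k : ℕ, ∀ t : ℤ, (k : ℤ) ≤ t → x t = 0) :
    {t : ℕ | conj (x (t : ℤ)) * LnLnAdj B n x t ≠ 0}.Finite ∧
    {t : ℕ | LnAdj B n x t ≠ 0}.Finite ∧
    ((∑ᶠ t : ℕ, conj (x (t : ℤ)) * LnLnAdj B n x t)
        = ∑ᶠ t : ℕ, (Complex.normSq (LnAdj B n x t) : ℂ)) ∧
    (∃ r : ℝ, 0 ≤ r ∧ (∑ᶠ t : ℕ, conj (x (t : ℤ)) * LnLnAdj B n x t) = (r : ℂ)) ∧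
    (∀ w : ℕ → ℝ, (∀ t : ℕ, 0 ≤ w t) →
      ∀ f : ℕ → ℂ, (∀ t : ℕ, LnLnAdj B n x t = (w t : ℂ) * f t) →
        ∃ r : ℝ, 0 ≤ r ∧ (∑ᶠ t : ℕ, conj (x (t : ℤ)) * ((w t : ℂ) * f t)) = (r : ℂ)) := by
  obtain ⟨k, hk⟩ := hxfin
  have hl : ∀ t : ℕ, conj (x (t : ℤ)) * LnLnAdj B n x t ≠ 0 → t < k := by
    intro t ht
    by_contra! h
    exact ht (by rw [hk _ (by exact_mod_cast h), map_zero, zero_mul])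
  have hr : ∀ t : ℕ, LnAdj B n x t ≠ 0 → t < k + n := by
    intro t ht
    by_contra! h
    exact ht (LnAdj_eq_zero_of_le hk h)
  have hsl : ∑ᶠ t : ℕ, conj (x (t : ℤ)) * LnLnAdj B n x t
      = ∑ t ∈ Finset.range (k + n), (Complex.normSq (LnAdj B n x t) : ℂ) := by
    rw [finsum_eq_sum_of_support_subset (s := Finset.range k) _
      fun t ht => by simpa using hl t ht]
    exact sum_conj_mul_LnLnAdj (fun t h₁ h₂ => hx0 t h₁ (by omega)) hk
  have hsr : ∑ᶠ t : ℕ, (Complex.normSq (LnAdj B n x t) : ℂ)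
      = ∑ t ∈ Finset.range (k + n), (Complex.normSq (LnAdj B n x t) : ℂ) :=
    finsum_eq_sum_of_support_subset _ fun t ht => by
      simpa using hr t (by simpa using ht)
  have hnonneg : ∃ r : ℝ, 0 ≤ r ∧
      ∑ᶠ t : ℕ, conj (x (t : ℤ)) * LnLnAdj B n x t = (r : ℂ) :=
    ⟨∑ t ∈ Finset.range (k + n), Complex.normSq (LnAdj B n x t),
      Finset.sum_nonneg fun _ _ => Complex.normSq_nonneg _, by rw [hsl, Complex.ofReal_sum]⟩
  refine ⟨(Set.finite_lt_nat k).subset hl, (Set.finite_lt_nat (k + n)).subset hr,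
    hsl.trans hsr.symm, hnonneg, fun w _ f hf => ?_⟩
  simpa only [hf] using hnonneg
end
end
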